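/- Let E = (E⁰, E¹) be a finite directed graph without multiple edges, D its adjacency matrix, B = Dᵀ, and let β ∈ ℝ satisfy e^β > ρ(B). Let S_β = { τ ∈ ℝ^{E⁰} : τ has nonnegative entries, Σ_{v∈E⁰} τ(v) = 1, and (Bτ)(w) = e^β τ(w) for every non-sink vertex w }. For each sink v of E, let δ_v ∈ ℝ^{E⁰} be the indicator vector of v, let σ_v = Σ_{i=0}^∞ e^{-iβ} B^i δ_v, and let τ_v = σ_v / (Σ_{u∈E⁰} σ_v(u)). Then S_β is a compact convex subset of ℝ^{E⁰}, the map v ↦ τ_v is injective on the set of sinks of E, and the set of extreme points of S_β is exactly { τ_v : v a sink of E }. (In particular, if E has no sinks then S_β is empty.) -/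

import Mathlib

/-- A vertex `v` is a sink if no edge starts at it. -/
def IsSink {V E : Type*} (s : E → V) (v : V) : Prop := ¬ ∃ e : E, s e = v

instance {V E : Type*} [Fintype E] [DecidableEq V] (s : E → V) (v : V) :
    Decidable (IsSink s v) :=
  inferInstanceAs (Decidable ¬ ∃ e : E, s e = v)

/-- The adjacency matrix of the graph with source map `s` and range map `r`:
`D i j = 1` iff there is an edge from `j` to `i`. -/
def adjMatrix (α : Type*) [Zero α] [One α] {V E : Type*} [Fintype E] [DecidableEq V]
    (s r : E → V) : Matrix V V α :=
  Matrix.of fun i j => if ∃ e : E, s e = j ∧ r e = i then 1 else 0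

/-- The set `S_β` of normalized nonnegative vectors `τ` with `(Bτ)(w) = e^β τ(w)` at every
non-sink vertex `w`; it corresponds to the set of `β`-KMS states on the graph C*-algebra. -/
def KMSVectors {V E : Type*} [Fintype V] [Fintype E] [DecidableEq V]
    (s r : E → V) (β : ℝ) : Set (V → ℝ) :=
  {τ | (∀ v, 0 ≤ τ v) ∧ (∑ v : V, τ v) = 1 ∧
    ∀ w : V, ¬ IsSink s w → (adjMatrix ℝ s r).transpose.mulVec τ w = Real.exp β * τ w}

/-- `σ_v = Σ_i e^{-iβ} Bⁱ δ_v`. -/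
noncomputable def sigmaVec {V E : Type*} [Fintype V] [Fintype E] [DecidableEq V]
    (s r : E → V) (β : ℝ) (v : V) : V → ℝ :=
  ∑' i : ℕ, Real.exp (-β) ^ i • ((adjMatrix ℝ s r).transpose ^ i).mulVec (Pi.single v 1)

/-- `τ_v`, the normalization of `σ_v`. -/
noncomputable def tauVec {V E : Type*} [Fintype V] [Fintype E] [DecidableEq V]
    (s r : E → V) (β : ℝ) (v : V) : V → ℝ :=
  (∑ u : V, sigmaVec s r β v u)⁻¹ • sigmaVec s r β v

theorem summable_norm_pow_of_spectralRadius_lt {A : Type*} [NormedRing A] [NormedAlgebra ℂ A]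
    [CompleteSpace A] {a : A} {R : ℝ} (h : spectralRadius ℂ a < ENNReal.ofReal R) :
    Summable fun n : ℕ => R⁻¹ ^ n * ‖a ^ n‖ := by
  have hR : 0 < R := ENNReal.ofReal_pos.mp (lt_of_le_of_lt (zero_le) h)
  obtain ⟨c, hc₁, hc₂⟩ := ENNReal.lt_iff_exists_nnreal_btwn.mp h
  have hcR : (c : ℝ) < R := by
    rw [← ENNReal.ofReal_coe_nnreal] at hc₂
    exact (ENNReal.ofReal_lt_ofReal_iff hR).mp hc₂
  have hbound : ∀ᶠ n : ℕ in Filter.atTop, ‖a ^ n‖ ≤ (c : ℝ) ^ n := by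
    filter_upwards [(spectrum.pow_nnnorm_pow_one_div_tendsto_nhds_spectralRadius a).eventually_lt_const
      hc₁, Filter.eventually_gt_atTop 0] with n hn hn0
    have h1 := ENNReal.rpow_le_rpow hn.le (Nat.cast_nonneg n : (0 : ℝ) ≤ n)
    rw [← ENNReal.rpow_mul, one_div_mul_cancel (by positivity), ENNReal.rpow_one,
      ENNReal.rpow_natCast] at h1
    exact_mod_cast h1
  refine Summable.of_norm_bounded_eventually_nat
    (summable_geometric_of_lt_one (by positivity) ((inv_mul_lt_one₀ hR).mpr hcR)) ?_
  filter_upwards [hbound] with n hn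
  rw [Real.norm_of_nonneg (by positivity), mul_pow]
  gcongr

section Neumann

variable {V : Type*} [Fintype V] [DecidableEq V]

section

attribute [local instance] Matrix.linftyOpNormedRing Matrix.linftyOpNormedAlgebra

theorem Matrix.norm_apply_le_linftyOpNorm (M : Matrix V V ℂ) (i j : V) : ‖M i j‖ ≤ ‖M‖ := by
  rw [Matrix.linfty_opNorm_def, ← coe_nnnorm, NNReal.coe_le_coe]
  exact (Finset.single_le_sum (f := fun j => ‖M i j‖₊) (fun _ _ => zero_le)
    (Finset.mem_univ j)).trans
    (Finset.le_sup (f := fun i => ∑ j, ‖M i j‖₊) (Finset.mem_univ i))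

theorem Matrix.summable_smul_pow_apply {B : Matrix V V ℝ} {R : ℝ}
    (h : spectralRadius ℂ (B.map (Complex.ofReal ·)) < ENNReal.ofReal R) (i j : V) :
    Summable fun n : ℕ => ((R⁻¹ • B) ^ n) i j := by
  have hR : 0 < R := ENNReal.ofReal_pos.mp (lt_of_le_of_lt (zero_le) h)
  refine Summable.of_norm_bounded (summable_norm_pow_of_spectralRadius_lt h) fun n => ?_
  have hmap : (B.map (Complex.ofReal ·)) ^ n = (B ^ n).map (Complex.ofReal ·) :=
    (map_pow (Complex.ofRealHom.mapMatrix (m := V)) B n).symm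
  have hle := Matrix.norm_apply_le_linftyOpNorm ((B.map (Complex.ofReal ·)) ^ n) i j
  rw [hmap, Matrix.map_apply, Complex.norm_real, ← hmap] at hle
  rw [smul_pow, Matrix.smul_apply, smul_eq_mul, norm_mul, norm_pow,
    Real.norm_of_nonneg (by positivity)]
  gcongr

end

variable {A : Matrix V V ℝ}

theorem Matrix.eq_zero_of_mulVec_eq_self (hA : ∀ i j, Summable fun n : ℕ => (A ^ n) i j)
    {x : V → ℝ} (hx : A.mulVec x = x) : x = 0 := by
  have hpow (n : ℕ) : (A ^ n).mulVec x = x := by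
    induction n with
    | zero => simp
    | succ n ih => rw [pow_succ, ← Matrix.mulVec_mulVec, hx, ih]
  funext i
  have hlim : Filter.Tendsto (fun n : ℕ => ∑ j, (A ^ n) i j * x j) Filter.atTop
      (nhds (∑ j, 0 * x j)) :=
    tendsto_finsetSum _ fun j _ => (hA i j).tendsto_atTop_zero.mul_const _
  have hconst : (fun n : ℕ => ∑ j, (A ^ n) i j * x j) = fun _ => x i :=
    funext fun n => congrFun (hpow n) i
  rw [hconst] at hlim
  simpa using tendsto_nhds_unique tendsto_const_nhds hlim

theorem Matrix.summable_pow_mulVec (hA : ∀ i j, Summable fun n : ℕ => (A ^ n) i j)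
    (x : V → ℝ) : Summable fun n : ℕ => (A ^ n).mulVec x :=
  Pi.summable.mpr fun i => summable_sum fun j _ => (hA i j).mul_right (x j)

theorem Matrix.tsum_pow_mulVec_eq (hA : ∀ i j, Summable fun n : ℕ => (A ^ n) i j)
    (x : V → ℝ) :
    ∑' n : ℕ, (A ^ n).mulVec x = x + A.mulVec (∑' n : ℕ, (A ^ n).mulVec x) := by
  have hs := Matrix.summable_pow_mulVec hA x
  have hmap := (LinearMap.toContinuousLinearMap A.mulVecLin).map_tsum hs
  simp only [LinearMap.coe_toContinuousLinearMap', Matrix.mulVecLin_apply,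
    Matrix.mulVec_mulVec, ← pow_succ'] at hmap
  rw [hmap, hs.tsum_eq_zero_add]
  simp

theorem Matrix.tsum_pow_mulVec_nonneg (hnn : ∀ i j, 0 ≤ A i j) {x : V → ℝ} (hx : 0 ≤ x) :
    0 ≤ ∑' n : ℕ, (A ^ n).mulVec x := by
  refine tsum_nonneg fun n => ?_
  induction n with
  | zero => simpa using hx
  | succ n ih =>
    rw [pow_succ', ← Matrix.mulVec_mulVec]
    exact fun i => Finset.sum_nonneg fun j _ => mul_nonneg (hnn i j) (ih j)

end Neumann

section Graph

variable {V E : Type*} [Fintype V] [Fintype E] [DecidableEq V] {s r : E → V} {β : ℝ}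

theorem adjMatrix_transpose_mulVec_of_isSink {w : V} (hw : IsSink s w) (x : V → ℝ) :
    (adjMatrix ℝ s r).transpose.mulVec x w = 0 :=
  Finset.sum_eq_zero fun j _ => by
    have : ¬ ∃ e : E, s e = w ∧ r e = j := fun ⟨e, he, _⟩ => hw ⟨e, he⟩
    simp [adjMatrix, this]

theorem sigmaVec_eq_tsum_pow_mulVec (v : V) :
    sigmaVec s r β v =
      ∑' n : ℕ, (((Real.exp β)⁻¹ • (adjMatrix ℝ s r).transpose) ^ n).mulVec (Pi.single v 1) := by
  simp only [sigmaVec, smul_pow, Matrix.smul_mulVec, Real.exp_neg]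

theorem sigmaVec_nonneg (v w : V) : 0 ≤ sigmaVec s r β v w := by
  rw [sigmaVec_eq_tsum_pow_mulVec]
  refine Matrix.tsum_pow_mulVec_nonneg (fun i j => ?_) (Pi.single_nonneg.mpr zero_le_one) w
  simp only [Matrix.smul_apply, Matrix.transpose_apply, adjMatrix, Matrix.of_apply, smul_eq_mul]
  split_ifs <;> positivity

theorem convex_KMSVectors : Convex ℝ (KMSVectors s r β) := by
  rintro x ⟨hx₀, hx₁, hx₂⟩ y ⟨hy₀, hy₁, hy₂⟩ a b ha hb hab
  refine ⟨fun v => add_nonneg (mul_nonneg ha (hx₀ v)) (mul_nonneg hb (hy₀ v)), ?_,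
    fun w hw => ?_⟩
  · simp [Finset.sum_add_distrib, ← Finset.mul_sum, hx₁, hy₁, hab]
  · simp only [Matrix.mulVec_add, Matrix.mulVec_smul, Pi.add_apply, Pi.smul_apply, smul_eq_mul,
      hx₂ w hw, hy₂ w hw]
    ring

variable (hρ : spectralRadius ℂ (((adjMatrix ℝ s r).transpose).map (Complex.ofReal ·)) <
  ENNReal.ofReal (Real.exp β))

include hρ

theorem sigmaVec_eq (v : V) :
    sigmaVec s r β v = Pi.single v 1 +
      ((Real.exp β)⁻¹ • (adjMatrix ℝ s r).transpose).mulVec (sigmaVec s r β v) := by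
  rw [sigmaVec_eq_tsum_pow_mulVec]
  exact Matrix.tsum_pow_mulVec_eq (Matrix.summable_smul_pow_apply hρ) _

theorem sigmaVec_apply_of_isSink (v : V) {w : V} (hw : IsSink s w) :
    sigmaVec s r β v w = (Pi.single v 1 : V → ℝ) w := by
  have h := congrFun (sigmaVec_eq hρ v) w
  simpa [Matrix.smul_mulVec, adjMatrix_transpose_mulVec_of_isSink hw] using h

theorem sum_sigmaVec_pos {v : V} (hv : IsSink s v) : 0 < ∑ u, sigmaVec s r β v u :=
  Finset.sum_pos' (fun u _ => sigmaVec_nonneg v u)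
    ⟨v, Finset.mem_univ v, by simp [sigmaVec_apply_of_isSink hρ v hv]⟩

theorem tauVec_apply_of_isSink_of_ne {v w : V} (hw : IsSink s w) (hne : w ≠ v) :
    tauVec s r β v w = 0 := by
  simp [tauVec, sigmaVec_apply_of_isSink hρ v hw, hne]

theorem tauVec_apply_self_pos {v : V} (hv : IsSink s v) : 0 < tauVec s r β v v := by
  simpa [tauVec, sigmaVec_apply_of_isSink hρ v hv] using sum_sigmaVec_pos hρ hv

theorem tauVec_injOn : Set.InjOn (tauVec s r β) {v : V | IsSink s v} := by
  intro v hv w hw h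
  by_contra hne
  have := tauVec_apply_self_pos hρ hv
  rw [h, tauVec_apply_of_isSink_of_ne hρ hv hne] at this
  exact this.false

theorem tauVec_mem_KMSVectors {v : V} (hv : IsSink s v) :
    tauVec s r β v ∈ KMSVectors s r β := by
  have hpos := sum_sigmaVec_pos hρ hv
  refine ⟨fun w => mul_nonneg (inv_nonneg.mpr hpos.le) (sigmaVec_nonneg v w), ?_, ?_⟩
  · simp only [tauVec, Pi.smul_apply, smul_eq_mul, ← Finset.mul_sum]
    exact inv_mul_cancel₀ hpos.ne'
  · intro w hw
    have hne : w ≠ v := fun h => hw (h ▸ hv)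
    have h := congrFun (sigmaVec_eq hρ v) w
    simp only [Pi.add_apply, Pi.single_eq_of_ne hne, zero_add, Matrix.smul_mulVec,
      Pi.smul_apply, smul_eq_mul] at h
    rw [eq_inv_mul_iff_mul_eq₀ (Real.exp_pos β).ne'] at h
    simp only [tauVec, Matrix.mulVec_smul, Pi.smul_apply, smul_eq_mul, ← h]
    ring

theorem eq_sum_smul_sigmaVec {τ : V → ℝ} (hτ : τ ∈ KMSVectors s r β) :
    τ = ∑ v with IsSink s v, τ v • sigmaVec s r β v := by
  rw [← sub_eq_zero]
  refine Matrix.eq_zero_of_mulVec_eq_self (Matrix.summable_smul_pow_apply hρ) ?_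
  set A := (Real.exp β)⁻¹ • (adjMatrix ℝ s r).transpose with hA
  have hτA : A.mulVec τ = τ - ∑ v with IsSink s v, τ v • Pi.single v 1 := by
    funext w
    rw [Pi.sub_apply, Finset.sum_apply, Finset.sum_filter]
    simp only [Pi.smul_apply, Pi.single_apply, smul_eq_mul, mul_ite, mul_one, mul_zero]
    rw [Finset.sum_eq_single w (fun v _ hv => by simp [hv.symm]) (by simp),
      hA, Matrix.smul_mulVec, Pi.smul_apply, smul_eq_mul]
    by_cases hw : IsSink s w
    · simp [hw, adjMatrix_transpose_mulVec_of_isSink hw]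
    · rw [hτ.2.2 w hw]
      simp [hw]
  have hσA (v : V) : A.mulVec (sigmaVec s r β v) = sigmaVec s r β v - Pi.single v 1 :=
    eq_sub_of_add_eq' (sigmaVec_eq hρ v).symm
  simp only [Matrix.mulVec_sub, hτA, Matrix.mulVec_sum, Matrix.mulVec_smul, hσA, smul_sub,
    Finset.sum_sub_distrib]
  abel

theorem sum_mul_sum_sigmaVec {τ : V → ℝ} (hτ : τ ∈ KMSVectors s r β) :
    ∑ v with IsSink s v, τ v * ∑ u, sigmaVec s r β v u = 1 := by
  have h := congrArg (fun x : V → ℝ => ∑ u, x u) (eq_sum_smul_sigmaVec hρ hτ)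
  simp only [hτ.2.1, Finset.sum_apply, Pi.smul_apply, smul_eq_mul] at h
  rw [Finset.sum_comm] at h
  simpa only [← Finset.mul_sum] using h.symm

theorem smul_sigmaVec_eq {v : V} (hv : IsSink s v) (c : ℝ) :
    c • sigmaVec s r β v = (c * ∑ u, sigmaVec s r β v u) • tauVec s r β v := by
  rw [tauVec, smul_smul, mul_inv_cancel_right₀ (sum_sigmaVec_pos hρ hv).ne']

theorem KMSVectors_eq_convexHull :
    KMSVectors s r β = convexHull ℝ (tauVec s r β '' {v : V | IsSink s v}) := by
  refine subset_antisymm (fun τ hτ => ?_) (convexHull_min ?_ convex_KMSVectors)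
  · have h : τ = ∑ v with IsSink s v, (τ v * ∑ u, sigmaVec s r β v u) • tauVec s r β v :=
      (eq_sum_smul_sigmaVec hρ hτ).trans <| Finset.sum_congr rfl fun v hv =>
        smul_sigmaVec_eq hρ (Finset.mem_filter.mp hv).2 _
    rw [h]
    refine (convex_convexHull ℝ _).sum_mem
      (fun v hv => mul_nonneg (hτ.1 v) (Finset.sum_nonneg fun u _ => sigmaVec_nonneg v u)) ?_
      (fun v hv => subset_convexHull ℝ _ ⟨v, (Finset.mem_filter.mp hv).2, rfl⟩)
    exact sum_mul_sum_sigmaVec hρ hτ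
  · rintro _ ⟨v, hv, rfl⟩
    exact tauVec_mem_KMSVectors hρ hv

theorem eq_tauVec_of_forall_isSink {τ : V → ℝ} (hτ : τ ∈ KMSVectors s r β) {v : V}
    (hv : IsSink s v) (h : ∀ w, IsSink s w → w ≠ v → τ w = 0) : τ = tauVec s r β v := by
  have hz {w : V} (hw : w ∈ Finset.univ.filter (IsSink s)) (hne : w ≠ v) : τ w = 0 :=
    h w (Finset.mem_filter.mp hw).2 hne
  have hc : τ v * ∑ u, sigmaVec s r β v u = 1 := by
    rw [← sum_mul_sum_sigmaVec hρ hτ]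
    symm
    exact Finset.sum_eq_single v (fun w hw hne => by rw [hz hw hne, zero_mul]) (by simp [hv])
  calc τ = τ v • sigmaVec s r β v := (eq_sum_smul_sigmaVec hρ hτ).trans
        (Finset.sum_eq_single v (fun w hw hne => by rw [hz hw hne, zero_smul]) (by simp [hv]))
    _ = tauVec s r β v := by rw [smul_sigmaVec_eq hρ hv, hc, one_smul]

theorem tauVec_mem_extremePoints {v : V} (hv : IsSink s v) :
    tauVec s r β v ∈ Set.extremePoints ℝ (KMSVectors s r β) := by
  refine mem_extremePoints_iff_left.mpr ⟨tauVec_mem_KMSVectors hρ hv, ?_⟩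
  rintro x hx y hy ⟨a, b, ha, hb, -, hxy⟩
  refine eq_tauVec_of_forall_isSink hρ hx hv fun w hw hne => ?_
  have h := congrFun hxy w
  rw [tauVec_apply_of_isSink_of_ne hρ hw hne] at h
  simp only [Pi.add_apply, Pi.smul_apply, smul_eq_mul] at h
  have h₁ := mul_nonneg ha.le (hx.1 w)
  have h₂ := mul_nonneg hb.le (hy.1 w)
  exact (mul_eq_zero.mp (by linarith : a * x w = 0)).resolve_left ha.ne'

end Graph

/-- For a finite graph without multiple edges and `e^β > ρ(B)`, the set
`S_β` is compact and convex, the map `v ↦ τ_v` is injective on the set of sinks, and the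
extreme points of `S_β` are exactly the `τ_v` for `v` a sink. -/
theorem stmt12 {V E : Type*} [Fintype V] [Fintype E] [DecidableEq V]
    (s r : E → V)
    (hsimple : ∀ e e' : E, s e = s e' → r e = r e' → e = e')
    (β : ℝ)
    (hρ : spectralRadius ℂ
        (((adjMatrix ℝ s r).transpose).map (Complex.ofReal ·)) <
      ENNReal.ofReal (Real.exp β)) :
    IsCompact (KMSVectors s r β) ∧ Convex ℝ (KMSVectors s r β) ∧
    Set.InjOn (tauVec s r β) {v : V | IsSink s v} ∧
    Set.extremePoints ℝ (KMSVectors s r β) = tauVec s r β '' {v : V | IsSink s v} := by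
  rw [and_iff_right (a := Convex ℝ _) convex_KMSVectors, and_iff_right (tauVec_injOn hρ)]
  refine ⟨?_, subset_antisymm ?_ ?_⟩
  · rw [KMSVectors_eq_convexHull hρ]
    exact ((Set.toFinite _).image _).isCompact_convexHull ℝ
  · conv_lhs => rw [KMSVectors_eq_convexHull hρ]
    exact extremePoints_convexHull_subset
  · rintro _ ⟨v, hv, rfl⟩
    exact tauVec_mem_extremePoints hρ hv
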